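/- arXiv:2412.16054 — 2 statements merged into one kernel-verified Lean document; each statement's English description precedes it below -/
import Mathlib

section
/- Let m ≥ 2, let q > −1 be real, let u = (u_1,…,u_m) ∈ S^{m−1}, let i, j ∈ {1,…,m} with i ≠ j, and let g = (g_1,…,g_m) be a standard Gaussian random vector in ℝ^m. Then E[ |⟨g,u⟩|^q · g_i g_j ] = q u_i u_j · 2^{q/2} Γ((q+1)/2) / √π, i.e. it equals q u_i u_j · E[|g_1|^q]. -/
open MeasureTheory ProbabilityTheory Real

lemma aux_moment (q : ℝ) (hq : -1 < q) :
    ∫ x, |x| ^ q ∂(gaussianReal 0 1) = 2 ^ (q / 2) * Real.Gamma ((q + 1) / 2) / Real.sqrt Real.pi := by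
  rw [integral_gaussianReal_eq_integral_smul one_ne_zero]
  have h1 : ∀ x : ℝ, gaussianPDFReal 0 1 x • |x| ^ q =
      (fun y : ℝ => (√(2 * π))⁻¹ * (y ^ q * rexp (-(1/2) * y ^ (2:ℝ)))) |x| := by
    intro x
    simp only [gaussianPDFReal_def, smul_eq_mul, rpow_two, sq_abs]
    simp only [NNReal.coe_one, mul_one, sub_zero]
    rw [show -x ^ 2 / 2 = -(1/2) * x ^ 2 by ring]
    ring
  rw [integral_congr_ae (Filter.Eventually.of_forall h1), integral_comp_abs
    (f := fun y : ℝ => (√(2 * π))⁻¹ * (y ^ q * rexp (-(1/2) * y ^ (2:ℝ)))), integral_const_mul,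
    integral_rpow_mul_exp_neg_mul_rpow two_pos hq (by norm_num : (0:ℝ) < 1/2)]
  have h2 : (1 / 2 : ℝ) ^ (-(q + 1) / 2) = 2 ^ (q / 2) * √2 := by
    rw [one_div, Real.inv_rpow (by norm_num), ← Real.rpow_neg (by norm_num),
      Real.sqrt_eq_rpow, ← Real.rpow_add (by norm_num)]
    congr 1; ring
  rw [h2, Real.sqrt_mul (by norm_num)]
  have : √2 ≠ 0 := by positivity
  have : √π ≠ 0 := by positivity
  field_simp

lemma aux_moment_pos (q : ℝ) (hq : -1 < q) :
    0 < 2 ^ (q / 2) * Real.Gamma ((q + 1) / 2) / Real.sqrt Real.pi := by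
  have : 0 < Real.Gamma ((q + 1) / 2) := Real.Gamma_pos_of_pos (by linarith)
  positivity

lemma aux_integrable (q : ℝ) (hq : -1 < q) :
    Integrable (fun x : ℝ => |x| ^ q) (gaussianReal 0 1) := by
  apply Integrable.of_integral_ne_zero
  rw [aux_moment q hq]
  exact (aux_moment_pos q hq).ne'

lemma aux_rec (q : ℝ) (hq : -1 < q) :
    2 ^ ((q + 2) / 2) * Real.Gamma ((q + 2 + 1) / 2) / Real.sqrt Real.pi =
    (q + 1) * (2 ^ (q / 2) * Real.Gamma ((q + 1) / 2) / Real.sqrt Real.pi) := by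
  rw [show (q + 2 + 1) / 2 = (q + 1) / 2 + 1 by ring, Real.Gamma_add_one (by linarith),
    show (q + 2) / 2 = q / 2 + 1 by ring, Real.rpow_add (by norm_num), Real.rpow_one]
  ring

/-- abstract computation -/
lemma aux_abstract {Ω : Type*} [MeasurableSpace Ω] (P : Measure Ω) [IsProbabilityMeasure P]
    (X A B : Ω → ℝ) (hX : Measurable X) (hA : Measurable A) (hB : Measurable B)
    (hlaw : P.map X = gaussianReal 0 1)
    (hA2 : MemLp A 2 P) (hB2 : MemLp B 2 P) (hA0 : ∫ ω, A ω ∂P = 0) (hB0 : ∫ ω, B ω ∂P = 0)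
    (hind : IndepFun X (fun ω => (A ω, B ω)) P) (a b : ℝ)
    (hAB : ∫ ω, A ω * B ω ∂P = -(a * b)) (q : ℝ) (hq : -1 < q) :
    ∫ ω, |X ω| ^ q * ((a * X ω + A ω) * (b * X ω + B ω)) ∂P =
      q * a * b * (2 ^ (q / 2) * Real.Gamma ((q + 1) / 2) / Real.sqrt Real.pi) := by
  have hm : ∀ r : ℝ, -1 < r → ∫ ω, |X ω| ^ r ∂P =
      2 ^ (r / 2) * Real.Gamma ((r + 1) / 2) / Real.sqrt Real.pi := by
    intro r hr
    rw [← aux_moment r hr, ← hlaw, integral_map hX.aemeasurable]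
    exact Measurable.aestronglyMeasurable (by fun_prop)
  have hi : ∀ r : ℝ, -1 < r → Integrable (fun ω => |X ω| ^ r) P := by
    intro r hr
    apply Integrable.of_integral_ne_zero
    rw [hm r hr]
    exact (aux_moment_pos r hr).ne'
  have hAi : Integrable A P := hA2.integrable (by norm_num)
  have hBi : Integrable B P := hB2.integrable (by norm_num)
  have hABi : Integrable (fun ω => A ω * B ω) P := hA2.integrable_mul hB2
  have hs : ∀ x : ℝ, |x| ^ q * x ^ 2 = |x| ^ (q + 2) := by
    intro x
    rcases eq_or_ne x 0 with rfl | hx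
    · rw [abs_zero, Real.zero_rpow (by linarith : q + 2 ≠ 0)]; simp
    · rw [Real.rpow_add (abs_pos.mpr hx), Real.rpow_two, sq_abs]
  have hone : Integrable (fun ω => |X ω| ^ q * X ω) P := by
    refine (hi (q + 1) (by linarith)).mono' (Measurable.aestronglyMeasurable (by fun_prop)) ?_
    refine Filter.Eventually.of_forall fun ω => ?_
    rw [norm_mul, Real.norm_eq_abs, Real.norm_eq_abs, abs_of_nonneg (by positivity)]
    rcases eq_or_ne (X ω) 0 with h0 | hx
    · rw [h0]; simp; positivity
    · rw [Real.rpow_add (abs_pos.mpr hx), Real.rpow_one]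
  have i1 : IndepFun (fun ω => |X ω| ^ q * X ω) (fun ω => a * B ω + b * A ω) P :=
    hind.comp (φ := fun x : ℝ => |x| ^ q * x) (ψ := fun p : ℝ × ℝ => a * p.2 + b * p.1)
      (by fun_prop) (by fun_prop)
  have i2 : IndepFun (fun ω => |X ω| ^ q) (fun ω => A ω * B ω) P :=
    hind.comp (φ := fun x : ℝ => |x| ^ q) (ψ := fun p : ℝ × ℝ => p.1 * p.2)
      (by fun_prop) (by fun_prop)
  have hlin : Integrable (fun ω => a * B ω + b * A ω) P :=
    (hBi.const_mul a).add (hAi.const_mul b)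
  have e : ∀ ω, |X ω| ^ q * ((a * X ω + A ω) * (b * X ω + B ω)) =
      (a * b) * |X ω| ^ (q + 2) + (|X ω| ^ q * X ω) * (a * B ω + b * A ω)
        + |X ω| ^ q * (A ω * B ω) := by
    intro ω
    rw [← hs]; ring
  have j1 : Integrable (fun ω => (|X ω| ^ q * X ω) * (a * B ω + b * A ω)) P :=
    i1.integrable_mul hone hlin
  have j2 : Integrable (fun ω => |X ω| ^ q * (A ω * B ω)) P :=
    i2.integrable_mul (hi q hq) hABi
  have j0 : Integrable (fun ω => (a * b) * |X ω| ^ (q + 2)) P :=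
    (hi (q + 2) (by linarith)).const_mul _
  simp_rw [e]
  have j01 : Integrable (fun ω => (a * b) * |X ω| ^ (q + 2) +
      (|X ω| ^ q * X ω) * (a * B ω + b * A ω)) P := j0.add j1
  rw [integral_add j01 j2, integral_add j0 j1, integral_const_mul,
    i1.integral_fun_mul_eq_mul_integral hone.1 hlin.1,
    i2.integral_fun_mul_eq_mul_integral (hi q hq).1 hABi.1,
    integral_add (hBi.const_mul a) (hAi.const_mul b), integral_const_mul, integral_const_mul,
    hA0, hB0, hAB, hm q hq, hm (q + 2) (by linarith), aux_rec q hq]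
  ring

/-- For `m ≥ 2`, `u ∈ S^{m−1}`, `q > −1`, `i ≠ j` and a standard Gaussian
vector `g` in `ℝ^m`, `E[|⟨g,u⟩|^q g_i g_j] = q u_i u_j · 2^{q/2} Γ((q+1)/2)/√π`. -/
theorem gaussian_power_times_mixed_moment (m : ℕ) (hm : 2 ≤ m) (q : ℝ) (hq : -1 < q)
    (u : Fin m → ℝ) (hu : ∑ k, u k ^ 2 = 1) (i j : Fin m) (hij : i ≠ j) :
    ∫ g : Fin m → ℝ,
        |∑ k, g k * u k| ^ q * (g i * g j)
        ∂(Measure.pi fun _ : Fin m => gaussianReal 0 1) =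
      q * u i * u j * (2 ^ (q / 2) * Real.Gamma ((q + 1) / 2) / Real.sqrt Real.pi) := by
  set P : Measure (Fin m → ℝ) := Measure.pi fun _ : Fin m => gaussianReal 0 1 with hP
  have hev : ∀ k, P.map (fun g => g k) = gaussianReal 0 1 := fun k =>
    (measurePreserving_eval (fun _ : Fin m => gaussianReal 0 1) k).map_eq
  have hgk : ∀ k, HasGaussianLaw (fun g : Fin m → ℝ => g k) P := fun k =>
    ⟨by rw [hev k]; infer_instance⟩
  have hii : iIndepFun (fun k (g : Fin m → ℝ) => g k) P :=
    iIndepFun_pi (X := fun _ => id) (fun _ => aemeasurable_id)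
  have hG : HasGaussianLaw (fun g : Fin m → ℝ => fun k => g k) P := hii.hasGaussianLaw hgk
  let X : (Fin m → ℝ) →L[ℝ] ℝ := ∑ k, u k • ContinuousLinearMap.proj k
  have hXe : ∀ g, X g = ∑ k, g k * u k := by
    intro g; simp [X, mul_comm]
  let Y : Fin m → (Fin m → ℝ) →L[ℝ] ℝ := fun k => ContinuousLinearMap.proj k - u k • X
  have hYe : ∀ k g, Y k g = g k - u k * X g := by intro k g; simp [Y]
  have hL : ∀ L : (Fin m → ℝ) →L[ℝ] ℝ, HasGaussianLaw (fun g => L g) P := fun L => hG.map_fun L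
  have hL2 : ∀ L : (Fin m → ℝ) →L[ℝ] ℝ, MemLp (fun g => L g) 2 P := fun L => (hL L).memLp_two
  have hg2 : ∀ k, MemLp (fun g : Fin m → ℝ => g k) 2 P := fun k => (hgk k).memLp_two
  have hmean : ∀ k, ∫ g, g k ∂P = 0 := by
    intro k
    have := integral_map (μ := P) (φ := fun g => g k) (measurable_pi_apply k).aemeasurable (f := fun x : ℝ => x)
      (by fun_prop)
    rw [← this, hev k]; simp
  have hXmean : ∫ g, X g ∂P = 0 := by
    simp_rw [hXe]
    rw [integral_finsetSum _ fun k _ => (hgk k).integrable.mul_const _]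
    simp [integral_mul_const, hmean]
  have hYmean : ∀ k, ∫ g, Y k g ∂P = 0 := by
    intro k
    simp_rw [hYe]
    rw [integral_sub (hgk k).integrable ((hL X).integrable.const_mul _), integral_const_mul,
      hXmean, hmean]
    simp
  have hcov : ∀ k l, cov[fun g => g k, fun g => g l; P] = if k = l then 1 else 0 := by
    intro k l
    split_ifs with h
    · subst h
      rw [covariance_self (measurable_pi_apply k).aemeasurable]
      have := variance_map (μ := P) (X := id) (Y := fun g : Fin m → ℝ => g k)
        (by fun_prop) (measurable_pi_apply k).aemeasurable
      rw [hev k, variance_id_gaussianReal] at this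
      simpa using this.symm
    · exact (hii.indepFun h).covariance_eq_zero (hg2 k) (hg2 l)
  have hXfun : (fun g => X g) = fun g : Fin m → ℝ => ∑ k, g k * u k := funext hXe
  have hcX : ∀ l, cov[fun g => X g, fun g => g l; P] = u l := by
    intro l
    rw [hXfun, covariance_fun_sum_left (fun k => (hg2 k).mul_const (u k)) (hg2 l)]
    simp [covariance_mul_const_left, hcov]
  have hcXX : cov[fun g => X g, fun g => X g; P] = 1 := by
    conv_lhs => rw [hXfun]
    rw [covariance_fun_sum_left (fun k => (hg2 k).mul_const (u k)) (by rw [← hXfun]; exact hL2 X)]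
    rw [← hXfun]
    simp_rw [covariance_mul_const_left]
    rw [← hu]
    refine Finset.sum_congr rfl fun k _ => ?_
    rw [covariance_comm, hcX]; ring
  have hYfun : ∀ k, (fun g => Y k g) = fun g : Fin m → ℝ => g k - u k * X g :=
    fun k => funext (hYe k)
  have hcXY : ∀ l, cov[fun g => X g, fun g => Y l g; P] = 0 := by
    intro l
    rw [hYfun, covariance_fun_sub_right (hL2 X) (hg2 l) ((hL2 X).const_mul _),
      covariance_const_mul_right, hcX, hcXX]
    ring
  have hcYY : cov[fun g => Y i g, fun g => Y j g; P] = -(u i * u j) := by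
    conv_lhs => rw [hYfun i]
    rw [covariance_fun_sub_left (hg2 i) ((hL2 X).const_mul _) (hL2 _),
      covariance_const_mul_left, hcXY, hYfun, covariance_fun_sub_right (hg2 i) (hg2 j)
      ((hL2 X).const_mul _), covariance_const_mul_right, hcov, if_neg hij, covariance_comm, hcX]
    ring
  have hlaw : P.map (fun g => X g) = gaussianReal 0 1 := by
    rw [(hL X).map_eq_gaussianReal, hXmean, ← covariance_self (by fun_prop), hcXX]
    simp
  have hXY : HasGaussianLaw (fun g => ((fun _ : Unit => X g), (fun k => Y k g))) P :=
    hG.map_fun ((ContinuousLinearMap.pi fun _ : Unit => X).prod (ContinuousLinearMap.pi Y))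
  have hind0 := HasGaussianLaw.indepFun_of_covariance_eval (X := fun (_ : Unit) g => X g)
    (Y := fun k g => Y k g) hXY (fun _ l => hcXY l)
  have hind : IndepFun (fun g => X g) (fun g => (Y i g, Y j g)) P :=
    hind0.comp (φ := fun f : Unit → ℝ => f ()) (ψ := fun f : Fin m → ℝ => (f i, f j))
      (by fun_prop) (by fun_prop)
  have hAB : ∫ g, Y i g * Y j g ∂P = -(u i * u j) := by
    have := covariance_eq_sub (hL2 (Y i)) (hL2 (Y j))
    rw [hcYY, hYmean, hYmean] at this
    simpa using this.symm
  have key := aux_abstract P (fun g => X g) (fun g => Y i g) (fun g => Y j g) (by fun_prop)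
    (by fun_prop) (by fun_prop) hlaw (hL2 _) (hL2 _) (hYmean i) (hYmean j) hind (u i) (u j)
    hAB q hq
  rw [← key]
  refine integral_congr_ae (Filter.Eventually.of_forall fun g => ?_)
  simp only [hYe, ← hXe]
  ring_nf
end

section
/- Let m ≥ 1, let q > −1/2 be real, let u, v ∈ S^{m−1} with ⟨u,v⟩² < 1, and let g be a standard Gaussian random vector in ℝ^m. Then E[ |⟨g,u⟩ · ⟨g,v⟩|^q ] = (2^q Γ((q+1)/2)² / π) · Σ_{n=0}^∞ [ ((−q/2)_n)² / ( (1/2)_n · n! ) ] · ⟨u,v⟩^{2n}, where (a)_n = a(a+1)···(a+n−1) denotes the rising factorial (Pochhammer symbol) with (a)_0 = 1; in other words the expectation equals (2^q Γ((q+1)/2)²/π) · ₂F₁(−q/2, −q/2; 1/2; ⟨u,v⟩²). -/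
open MeasureTheory ProbabilityTheory Real

/-- The rising factorial (Pochhammer symbol) `(a)_n = a(a+1)⋯(a+n−1)`, with `(a)_0 = 1`. -/
noncomputable def risingFactorial (a : ℝ) (n : ℕ) : ℝ :=
  ∏ k ∈ Finset.range n, (a + k)

open scoped RealInnerProductSpace

lemma gm_inner_law {E : Type*} [NormedAddCommGroup E] [InnerProductSpace ℝ E] [FiniteDimensional ℝ E]
    [MeasurableSpace E] [BorelSpace E] (u : E) (hu : ⟪u, u⟫ = 1) :
    (stdGaussian E).map (fun x => ⟪u, x⟫) = gaussianReal 0 1 := by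
  have h : HasGaussianLaw (fun x => ⟪u, x⟫) (stdGaussian E) :=
    (IsGaussian.hasGaussianLaw_id (μ := stdGaussian E)).map_fun (innerSL ℝ u)
  rw [h.map_eq_gaussianReal]
  have h1 : ∫ x, ⟪u, x⟫ ∂(stdGaussian E) = 0 := integral_strongDual_stdGaussian (innerSL ℝ u)
  have h2 : Var[fun x => ⟪u, x⟫; stdGaussian E] = 1 := by
    rw [← covariance_self h.aemeasurable, ← covarianceBilin_apply_eq_cov, covarianceBilin_stdGaussian]
    · exact hu
    · exact IsGaussian.memLp_two_id
  rw [h1, h2]; simp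

lemma gm_pair_law {E : Type*} [NormedAddCommGroup E] [InnerProductSpace ℝ E] [FiniteDimensional ℝ E]
    [MeasurableSpace E] [BorelSpace E] (u w : E) (hu : ⟪u, u⟫ = 1) (hw : ⟪w, w⟫ = 1)
    (huw : ⟪u, w⟫ = 0) :
    (stdGaussian E).map (fun x => (⟪u, x⟫, ⟪w, x⟫)) = (gaussianReal 0 1).prod (gaussianReal 0 1) := by
  have h : HasGaussianLaw (fun x => (⟪u, x⟫, ⟪w, x⟫)) (stdGaussian E) :=
    (IsGaussian.hasGaussianLaw_id (μ := stdGaussian E)).map_fun ((innerSL ℝ u).prod (innerSL ℝ w))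
  have hi := h.indepFun_of_covariance_eq_zero (by
    rw [← covarianceBilin_apply_eq_cov, covarianceBilin_stdGaussian]
    · exact huw
    · exact IsGaussian.memLp_two_id)
  rw [indepFun_iff_map_prod_eq_prod_map_map (by fun_prop) (by fun_prop)] at hi
  rw [hi, gm_inner_law u hu, gm_inner_law w hw]

lemma gm_pi_law (m : ℕ) (u w : Fin m → ℝ) (hu : ∑ j, u j ^ 2 = 1) (hw : ∑ j, w j ^ 2 = 1)
    (huw : ∑ j, u j * w j = 0) :
    (Measure.pi fun _ : Fin m => gaussianReal 0 1).map
      (fun g => (∑ j, g j * u j, ∑ j, g j * w j)) = (gaussianReal 0 1).prod (gaussianReal 0 1) := by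
  rw [← gm_pair_law (WithLp.toLp 2 u : EuclideanSpace ℝ (Fin m)) (WithLp.toLp 2 w)
    (by rw [PiLp.inner_apply]; simpa [pow_two] using hu)
    (by rw [PiLp.inner_apply]; simpa [pow_two] using hw)
    (by simpa [PiLp.inner_apply, mul_comm] using huw), ← map_pi_eq_stdGaussian,
    Measure.map_map (by fun_prop) (by fun_prop)]
  congr 1

lemma gm_rf_succ (a : ℝ) (n : ℕ) : risingFactorial a (n+1) = risingFactorial a n * (a + n) := by
  simp [risingFactorial, Finset.prod_range_succ]

lemma gm_rf_pos {a : ℝ} (ha : 0 < a) (n : ℕ) : 0 < risingFactorial a n := by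
  unfold risingFactorial
  exact Finset.prod_pos fun k _ => by positivity

noncomputable def gmC (a c : ℝ) (n : ℕ) : ℝ :=
  risingFactorial a n ^ 2 / (risingFactorial c n * (n.factorial : ℝ))

lemma gmC_succ (a : ℝ) {c : ℝ} (hc : 0 < c) (n : ℕ) :
    gmC a c (n+1) * ((c + n) * (n + 1)) = (a + n)^2 * gmC a c n := by
  unfold gmC
  have h1 := (gm_rf_pos hc n).ne'
  have h2 : c + n ≠ 0 := by positivity
  rw [gm_rf_succ, gm_rf_succ, Nat.factorial_succ]
  push_cast
  have h3 : (n.factorial : ℝ) ≠ 0 := by positivity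
  have h4 : (n : ℝ) + 1 ≠ 0 := by positivity
  field_simp

lemma gmC_zero (a c : ℝ) : gmC a c 0 = 1 := by simp [gmC, risingFactorial]

open PowerSeries in
lemma gm_coeff (c k l : ℝ) (F : PowerSeries ℝ) (n : ℕ) :
    coeff n ((X * (1 - X)) * (d⁄dX ℝ (d⁄dX ℝ F)) + (C c - C k * X) * d⁄dX ℝ F - C l * F) =
    coeff (n+1) F * ((c + n) * (n + 1)) - coeff n F * (n * (n - 1) + k * n + l) := by
  have e : (X * (1 - X)) * (d⁄dX ℝ (d⁄dX ℝ F)) + (C c - C k * X) * d⁄dX ℝ F - C l * F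
    = X * (d⁄dX ℝ (d⁄dX ℝ F)) - X * (X * (d⁄dX ℝ (d⁄dX ℝ F))) + C c * d⁄dX ℝ F
      - C k * (X * d⁄dX ℝ F) - C l * F := by ring
  rw [e]
  simp only [map_add, map_sub, coeff_C_mul]
  rcases n with _ | _ | n
  · simp only [coeff_zero_X_mul, coeff_derivative]
    push_cast
    ring
  · simp only [coeff_zero_X_mul, coeff_derivative, coeff_succ_X_mul]
    push_cast
    ring
  · simp only [coeff_zero_X_mul, coeff_derivative, coeff_succ_X_mul]
    push_cast
    ring

open PowerSeries in
lemma gm_ode (a : ℝ) {c : ℝ} (hc : 0 < c) (F : PowerSeries ℝ) (hF : F = PowerSeries.mk (gmC a c)) :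
    (X * (1 - X)) * (d⁄dX ℝ (d⁄dX ℝ F)) + (C c - C (2*a+1) * X) * d⁄dX ℝ F - C (a^2) * F = 0 := by
  ext n
  rw [gm_coeff, hF, coeff_mk, coeff_mk, gmC_succ a hc]
  simp only [map_zero]
  ring

open PowerSeries in
lemma gm_ode_unique (a : ℝ) {c : ℝ} (hc : 0 < c) (G : PowerSeries ℝ) (h0 : coeff 0 G = 1)
    (h : (X * (1 - X)) * (d⁄dX ℝ (d⁄dX ℝ G)) + (C c - C (2*a+1) * X) * d⁄dX ℝ G - C (a^2) * G = 0)
    (n : ℕ) : coeff n G = gmC a c n := by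
  induction n with
  | zero => rw [h0, gmC_zero]
  | succ n ih =>
    have hr := congrArg (coeff n) h
    rw [gm_coeff, map_zero, ih] at hr
    have := gmC_succ a hc n
    have h3 : (c + n) * ((n : ℝ) + 1) ≠ 0 := by positivity
    refine mul_right_cancel₀ h3 ?_
    rw [this]
    linear_combination hr

open PowerSeries in
lemma gm_euler_formal (a : ℝ) {c : ℝ} (hc : 0 < c) (B F : PowerSeries ℝ)
    (hF : F = PowerSeries.mk (gmC a c)) (hB0 : coeff 0 B = 1)
    (hB : (1 - X) * d⁄dX ℝ B = - (C (2*a-c) * B)) (n : ℕ) :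
    coeff n (B * F) = gmC (c - a) c n := by
  have ode := gm_ode a hc F hF
  refine gm_ode_unique (c-a) hc _ ?_ ?_ n
  · rw [hF]; simp at hB0; simp [hB0, gmC_zero]
  have hne : (1 - X : PowerSeries ℝ) ≠ 0 := by
    intro h
    have := congrArg (coeff 0) h
    simp at this
  apply mul_left_cancel₀ hne
  have hB2 := congrArg (d⁄dX ℝ) hB
  simp only [Derivation.leibniz, map_sub, map_neg, smul_eq_mul, map_one, derivative_C,
    PowerSeries.derivative_X, map_add, map_mul, map_pow, map_ofNat] at *
  have hd2 : (d⁄dX ℝ) (2 : PowerSeries ℝ) = 0 := by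
    exact_mod_cast Derivation.map_natCast (d⁄dX ℝ) 2
  simp only [Derivation.map_one_eq_zero, hd2] at hB2
  generalize (d⁄dX ℝ) ((d⁄dX ℝ) B) = B2 at *
  generalize (d⁄dX ℝ) ((d⁄dX ℝ) F) = F2 at *
  generalize (d⁄dX ℝ) F = F1 at *
  generalize (d⁄dX ℝ) B = B1 at *
  generalize (C a : PowerSeries ℝ) = a at *
  generalize (C c : PowerSeries ℝ) = c at *
  generalize (X : PowerSeries ℝ) = X at *
  linear_combination B*(1-X)*ode + F1*(1-X)*2*X*hB + F*X*(1-X)*hB2 +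
    F*(X*(1-(2*a-c))+c-(2*(c-a)+1)*X)*hB

lemma gm_binom (s : ℝ) : ∃ b : ℕ → ℝ, b 0 = 1 ∧ (∀ n : ℕ, b (n+1) * (n+1) = (n - s) * b n) ∧
    ∀ z : ℝ, |z| < 1 → HasSum (fun n => b n * z ^ n) ((1 - z) ^ s) := by
  refine ⟨fun n => Ring.choose s n * (-1)^n, by simp, fun n => ?_, fun z hz => ?_⟩
  · have h1 := Ring.descPochhammer_eq_factorial_smul_choose s (n+1)
    have h2 := Ring.descPochhammer_eq_factorial_smul_choose s n
    rw [descPochhammer_succ_right, Polynomial.smeval_mul, h2] at h1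
    simp [Polynomial.smeval_sub, Polynomial.smeval_X, Polynomial.smeval_natCast, Nat.factorial_succ] at h1
    have h3 : (n.factorial : ℝ) ≠ 0 := by positivity
    have h4 : Ring.choose s n * (s - n) = (n+1) * Ring.choose s (n+1) := by
      apply mul_left_cancel₀ h3
      linear_combination h1
    simp only [pow_succ]
    linear_combination (-1)^n * h4
  · have := (Real.one_add_rpow_hasFPowerSeriesOnBall_zero (a := s)).hasSum (y := -z) (by
      simpa [Metric.eball, edist_dist, enorm_eq_nnnorm] using! hz)
    simp only [binomialSeries_apply, zero_add, List.ofFn_const, List.prod_replicate, smul_eq_mul] at this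
    have e : (fun n => Ring.choose s n * (-1) ^ n * z ^ n) = fun n => Ring.choose s n * (-z) ^ n := by
      ext n
      rw [neg_pow z]; ring
    rw [e, sub_eq_add_neg]
    exact this

lemma gm_summable {a c : ℝ} (ha : 0 < a) (hc : 0 < c) {z : ℝ} (hz0 : 0 ≤ z) (hz : z < 1) :
    Summable (fun n => gmC a c n * z ^ n) := by
  rcases hz0.eq_or_lt with rfl | hz0
  · apply summable_of_ne_finset_zero (s := {0})
    intro n hn
    simp at hn
    simp [hn]
  have hp : ∀ n, 0 < gmC a c n := fun n => by
    have := gm_rf_pos ha n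
    have := gm_rf_pos hc n
    unfold gmC
    positivity
  refine summable_of_ratio_test_tendsto_lt_one hz (Filter.Eventually.of_forall fun n => (mul_pos (hp n) (pow_pos hz0 n)).ne') ?_
  have h1 : Filter.Tendsto (fun n : ℕ => ((a + n)/(c + n)) * ((a+n)/(1 + n)) * z) Filter.atTop (nhds (1 * 1 * z)) := by
    have h (a c : ℝ) : Filter.Tendsto (fun n : ℕ => ((a + n)/(c + n))) Filter.atTop (nhds 1) := by
      simpa using tendsto_add_mul_div_add_mul_atTop_nhds a c 1 (one_ne_zero (α := ℝ))
    exact ((h a c).mul (h a 1)).mul_const z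
  rw [one_mul, one_mul] at h1
  refine h1.congr fun n => ?_
  have h2 := gmC_succ a hc n
  rw [Real.norm_of_nonneg (mul_pos (hp _) (pow_pos hz0 _)).le, Real.norm_of_nonneg (mul_pos (hp _) (pow_pos hz0 _)).le]
  have := (hp n).ne'
  have h5 : (1:ℝ) + n ≠ 0 := by positivity
  rw [eq_div_iff (by have := hp n; positivity)]
  field_simp
  rw [pow_succ]
  linear_combination -z^n * z * h2

open PowerSeries in
lemma gm_euler {a c : ℝ} (ha : 0 < a) (hc : 0 < c) {z : ℝ} (hz0 : 0 ≤ z) (hz : z < 1) :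
    (1 - z) ^ (2 * a - c) * ∑' n, gmC a c n * z ^ n = ∑' n, gmC (c - a) c n * z ^ n := by
  obtain ⟨b, hb0, hb1, hb⟩ := gm_binom (2*a-c)
  have hb := hb z (by rwa [abs_of_nonneg hz0])
  rw [← hb.tsum_eq, tsum_mul_tsum_eq_tsum_sum_antidiagonal_of_summable_norm hb.summable.norm
    (gm_summable ha hc hz0 hz).norm]
  congr 1
  ext n
  have := gm_euler_formal a hc (PowerSeries.mk b) (PowerSeries.mk (gmC a c)) rfl (by simpa using hb0)
    (by
      ext n
      rw [sub_mul, one_mul, map_sub, map_neg, coeff_C_mul]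
      have := hb1 n
      rcases n with _ | n
      · simp [coeff_derivative] at *
        linarith
      · simp [coeff_derivative, coeff_succ_X_mul] at *
        linarith) n
  rw [← this, coeff_mul, Finset.sum_mul]
  refine Finset.sum_congr rfl fun p hp => ?_
  rw [Finset.HasAntidiagonal.mem_antidiagonal] at hp
  rw [← hp, pow_add, coeff_mk, coeff_mk]
  ring

noncomputable def gmM (b p : ℝ) : ℝ := b ^ (-(p + 1) / 2) * Real.Gamma ((p + 1) / 2)

lemma gmM_pos {b p : ℝ} (hb : 0 < b) (hp : -1 < p) : 0 < gmM b p := by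
  unfold gmM
  have := Real.Gamma_pos_of_pos (show 0 < (p+1)/2 by linarith)
  positivity

lemma gm_moment {b p : ℝ} (hb : 0 < b) (hp : -1 < p) :
    ∫⁻ x : ℝ, ENNReal.ofReal (|x| ^ p * exp (-b * x ^ 2)) = ENNReal.ofReal (gmM b p) := by
  have h : ∫ x : ℝ, |x| ^ p * exp (-b * x ^ 2) = gmM b p := by
    have h1 := integral_comp_abs (f := fun x : ℝ => x ^ p * exp (-b * x ^ 2))
    simp only [sq_abs] at h1
    have h2 := integral_rpow_mul_exp_neg_mul_rpow (p := 2) (by norm_num) hp hb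
    simp only [Real.rpow_two] at h2
    rw [h1, h2, gmM]
    ring
  rw [← h, ofReal_integral_eq_lintegral_ofReal]
  · by_contra hc
    rw [integral_undef hc] at h
    exact (gmM_pos hb hp).ne h
  · exact Filter.Eventually.of_forall fun x => by positivity

lemma gm_abs_pow {q : ℝ} (hq : -1 < q) (y : ℝ) (n : ℕ) :
    |y| ^ q * y ^ (2 * n) = |y| ^ (q + (2 * n : ℕ)) := by
  rw [← Even.pow_abs (n := 2 * n) (by simp) y]
  rcases (abs_nonneg y).eq_or_lt with h | h
  · rw [← h]
    rcases n with _ | n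
    · simp
    · rw [Real.zero_rpow (x := q + _)]
      · simp
      · push_cast; nlinarith [(Nat.cast_nonneg n : (0:ℝ) ≤ n)]
  · rw [Real.rpow_add_natCast h.ne']

lemma gm_pow_moment {b q : ℝ} (hb : 0 < b) (hq : -1 < q) (n : ℕ) (k : ℝ) (hk : 0 ≤ k) :
    ∫⁻ y : ℝ, ENNReal.ofReal (|y| ^ q * exp (-b * y ^ 2)) * ENNReal.ofReal (k * y ^ (2 * n)) =
      ENNReal.ofReal (k * gmM b (q + (2 * n : ℕ))) := by
  have hq' : -1 < q + (2 * n : ℕ) := by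
    have : (0:ℝ) ≤ (2 * n : ℕ) := Nat.cast_nonneg _
    linarith
  rw [ENNReal.ofReal_mul hk, ← gm_moment hb hq', ← lintegral_const_mul _ (by fun_prop)]
  refine lintegral_congr fun y => ?_
  rw [← ENNReal.ofReal_mul (by positivity), ← ENNReal.ofReal_mul hk, ← gm_abs_pow hq]
  congr 1; ring

lemma gm_inner_series {b q : ℝ} (hb : 0 < b) (hq : -1 < q) (t : ℝ) :
    ∫⁻ y : ℝ, ENNReal.ofReal (|y| ^ q * exp (-b * y ^ 2)) * ENNReal.ofReal (exp (t * y)) =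
      ∑' n : ℕ, ENNReal.ofReal (t ^ (2 * n) / (2 * n).factorial * gmM b (q + (2 * n : ℕ))) := by
  have hm : ∀ t : ℝ, Measurable fun y : ℝ => ENNReal.ofReal (|y| ^ q * exp (-b * y ^ 2)) * ENNReal.ofReal (exp (t * y)) := by
    intro t; fun_prop
  have h1 : ∫⁻ y : ℝ, ENNReal.ofReal (|y| ^ q * exp (-b * y ^ 2)) * ENNReal.ofReal (exp (t * y)) =
      ∫⁻ y : ℝ, ENNReal.ofReal (|y| ^ q * exp (-b * y ^ 2)) * ENNReal.ofReal (exp (-t * y)) := by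
    have := (Measure.measurePreserving_neg (volume : Measure ℝ)).lintegral_comp (hm t)
    rw [← this]
    refine lintegral_congr fun y => ?_
    simp
  have h2 : ∫⁻ y : ℝ, ENNReal.ofReal (|y| ^ q * exp (-b * y ^ 2)) * ENNReal.ofReal (exp (t * y)) =
      ∫⁻ y : ℝ, ENNReal.ofReal (|y| ^ q * exp (-b * y ^ 2)) * ENNReal.ofReal (cosh (t * y)) := by
    have h3 : 2 * ∫⁻ y : ℝ, ENNReal.ofReal (|y| ^ q * exp (-b * y ^ 2)) * ENNReal.ofReal (exp (t * y)) =
       2 * ∫⁻ y : ℝ, ENNReal.ofReal (|y| ^ q * exp (-b * y ^ 2)) * ENNReal.ofReal (cosh (t * y)) := by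
      conv_lhs => rw [two_mul]; arg 2; rw [h1]
      rw [← lintegral_add_left (hm t), ← lintegral_const_mul _ (by fun_prop)]
      refine lintegral_congr fun y => ?_
      rw [← mul_add, ← ENNReal.ofReal_add (by positivity) (by positivity), mul_left_comm]
      congr 1
      rw [show (2 : ENNReal) = ENNReal.ofReal 2 by simp, ← ENNReal.ofReal_mul (by norm_num), cosh_eq]
      congr 1
      rw [neg_mul]; ring
    exact (ENNReal.mul_right_inj (by simp) (by simp)).1 h3
  rw [h2]
  calc _ = ∫⁻ y : ℝ, ∑' n : ℕ, ENNReal.ofReal (|y| ^ q * exp (-b * y ^ 2)) *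
        ENNReal.ofReal (t ^ (2 * n) / (2 * n).factorial * y ^ (2 * n)) := by
        refine lintegral_congr fun y => ?_
        rw [ENNReal.tsum_mul_left, cosh_eq_tsum, ENNReal.ofReal_tsum_of_nonneg]
        · congr 2; ext n; congr 1; rw [mul_pow]; ring
        · intro n; rw [pow_mul]; positivity
        · exact (Real.hasSum_cosh _).summable
    _ = _ := by
      rw [lintegral_tsum (fun n => by fun_prop)]
      congr 1; ext n
      refine gm_pow_moment hb hq n _ ?_
      rw [pow_mul]; positivity

lemma gm_double_series {b q : ℝ} (hb : 0 < b) (hq : -1 < q) (K c : ℝ) (hK : 0 ≤ K) :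
    ∫⁻ x : ℝ, ∫⁻ y : ℝ, ENNReal.ofReal (K * (|x| ^ q * exp (-b * x ^ 2)) *
      (|y| ^ q * exp (-b * y ^ 2)) * exp (c * x * y)) =
      ∑' n : ℕ, ENNReal.ofReal (K * (c ^ (2 * n) / (2 * n).factorial * gmM b (q + (2 * n : ℕ)) ^ 2)) := by
  have hM : ∀ n : ℕ, 0 ≤ gmM b (q + (2 * n : ℕ)) := fun n => by
    have : (0:ℝ) ≤ (2 * n : ℕ) := Nat.cast_nonneg _
    exact (gmM_pos hb (by linarith)).le
  calc _ = ∫⁻ x : ℝ, ∑' n : ℕ, ENNReal.ofReal (|x| ^ q * exp (-b * x ^ 2)) *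
        ENNReal.ofReal (K * (c ^ (2 * n) / (2 * n).factorial * gmM b (q + (2 * n : ℕ))) * x ^ (2 * n)) := by
        refine lintegral_congr fun x => ?_
        have : ∀ y : ℝ, ENNReal.ofReal (K * (|x| ^ q * exp (-b * x ^ 2)) *
          (|y| ^ q * exp (-b * y ^ 2)) * exp (c * x * y)) =
          ENNReal.ofReal (K * (|x| ^ q * exp (-b * x ^ 2))) * 
            (ENNReal.ofReal (|y| ^ q * exp (-b * y ^ 2)) * ENNReal.ofReal (exp (c * x * y))) := by
          intro y
          rw [← ENNReal.ofReal_mul (by positivity), ← ENNReal.ofReal_mul (by positivity), mul_assoc]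
        simp_rw [this]
        rw [lintegral_const_mul _ (by fun_prop), gm_inner_series hb hq, ← ENNReal.tsum_mul_left]
        congr 1; ext n
        rw [← ENNReal.ofReal_mul (by positivity), ← ENNReal.ofReal_mul (by positivity), mul_pow]
        congr 1; ring
    _ = _ := by
      rw [lintegral_tsum (fun n => by fun_prop)]
      congr 1; ext n
      rw [gm_pow_moment hb hq n]
      · congr 1; ring
      · have := hM n
        rw [pow_mul]; positivity

lemma gm_gauss_double {q : ℝ} (ρ : ℝ) (hρ : ρ ^ 2 < 1) :
    ∫⁻ p : ℝ × ℝ, ENNReal.ofReal (|p.1 * (ρ * p.1 + √(1 - ρ ^ 2) * p.2)| ^ q)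
      ∂((gaussianReal 0 1).prod (gaussianReal 0 1)) =
    ∫⁻ x : ℝ, ∫⁻ y : ℝ, ENNReal.ofReal (((2 * π)⁻¹ * (√(1 - ρ^2))⁻¹) *
      (|x| ^ q * exp (-(2 * (1 - ρ^2))⁻¹ * x ^ 2)) *
      (|y| ^ q * exp (-(2 * (1 - ρ^2))⁻¹ * y ^ 2)) * exp ((ρ / (1 - ρ ^ 2)) * x * y)) := by
  have hs : 0 < 1 - ρ ^ 2 := by linarith
  set s := 1 - ρ ^ 2 with hsdef
  obtain ⟨v, hv⟩ : ∃ v : NNReal, (v : ℝ) = s := ⟨NNReal.mk s hs.le, rfl⟩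
  rw [lintegral_prod _ (by fun_prop)]
  have h1 : ∀ x : ℝ, ∫⁻ w, ENNReal.ofReal (|x * (ρ * x + √s * w)| ^ q) ∂(gaussianReal 0 1) =
      ∫⁻ y, ENNReal.ofReal (gaussianPDFReal (ρ * x) v y) * ENNReal.ofReal (|x * y| ^ q) := by
    intro x
    have hl : (gaussianReal 0 1).map (fun w => ρ * x + √s * w) = gaussianReal (ρ * x) v := by
      have : (fun w => ρ * x + √s * w) = (fun w => ρ * x + w) ∘ (fun w => √s * w) := rfl
      rw [this, ← Measure.map_map (by fun_prop) (by fun_prop), gaussianReal_map_const_mul,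
        gaussianReal_map_const_add]
      congr 1
      · simp
      · ext; simp [Real.sq_sqrt hs.le, hv]
    rw [← lintegral_map (f := fun y => ENNReal.ofReal (|x * y| ^ q)) (g := fun w => ρ * x + √s * w)
      (by fun_prop) (by fun_prop), hl, gaussianReal_of_var_ne_zero,
      lintegral_withDensity_eq_lintegral_mul _ (by fun_prop) (by fun_prop)]
    · rfl
    · intro h
      rw [h] at hv; exact hs.ne hv
  simp_rw [h1]
  rw [gaussianReal_of_var_ne_zero _ one_ne_zero, lintegral_withDensity_eq_lintegral_mul₀ (by fun_prop)]
  · refine lintegral_congr fun x => ?_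
    simp only [Pi.mul_apply, gaussianPDF]
    rw [← lintegral_const_mul _ (by fun_prop)]
    refine lintegral_congr fun y => ?_
    have hn := gaussianPDFReal_nonneg
    rw [← ENNReal.ofReal_mul (hn _ _ _), ← ENNReal.ofReal_mul (hn _ _ _)]
    congr 1
    rw [gaussianPDFReal, gaussianPDFReal, abs_mul, Real.mul_rpow (abs_nonneg _) (abs_nonneg _)]
    have e1 : (√(2 * π * (1 : NNReal)))⁻¹ * (√(2 * π * (v : ℝ)))⁻¹ = (2 * π)⁻¹ * (√s)⁻¹ := by
      simp only [NNReal.coe_one, mul_one, hv]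
      rw [Real.sqrt_mul (by positivity) s, mul_inv, ← mul_assoc, ← mul_inv,
        Real.mul_self_sqrt (by positivity)]
    have e2 : rexp (-(x - 0) ^ 2 / (2 * (1 : NNReal))) * rexp (-(y - ρ * x) ^ 2 / (2 * (v : ℝ)))
       = rexp (-(2 * s)⁻¹ * x ^ 2) * rexp (-(2 * s)⁻¹ * y ^ 2) * rexp (ρ / s * x * y) := by
      rw [← Real.exp_add, ← Real.exp_add, ← Real.exp_add]
      congr 1
      simp only [NNReal.coe_one, mul_one, hv]
      field_simp
      rw [hsdef]
      ring
    linear_combination (|x|^q * |y|^q * (rexp (-(x - 0) ^ 2 / (2 * (1 : NNReal))) * rexp (-(y - ρ * x) ^ 2 / (2 * (v : ℝ))))) * e1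
      + (|x|^q * |y|^q) * ((2 * π)⁻¹ * (√s)⁻¹) * e2
  · simp_rw [gaussianPDFReal]
    fun_prop

lemma gm_gamma {a : ℝ} (ha : 0 < a) (n : ℕ) :
    Real.Gamma (a + n) = risingFactorial a n * Real.Gamma a := by
  induction n with
  | zero => simp [risingFactorial]
  | succ n ih =>
    have : a + n ≠ 0 := by positivity
    rw [gm_rf_succ, Nat.cast_succ, ← add_assoc, Real.Gamma_add_one this, ih]
    ring

lemma gm_fact (n : ℕ) :
    ((2 * n).factorial : ℝ) = 4 ^ n * (risingFactorial (1/2) n * n.factorial) := by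
  induction n with
  | zero => simp [risingFactorial]
  | succ n ih =>
    rw [gm_rf_succ, show 2 * (n+1) = 2 * n + 1 + 1 by ring, Nat.factorial_succ, Nat.factorial_succ,
      Nat.factorial_succ]
    push_cast
    rw [ih]
    ring

lemma gm_term {q : ℝ} (hq : -1 < q) {s : ℝ} (hs : 0 < s) (ρ : ℝ) (n : ℕ) :
    ((2 * π)⁻¹ * (√s)⁻¹) * ((ρ / s) ^ (2 * n) / (2 * n).factorial *
      gmM ((2 * s)⁻¹) (q + (2 * n : ℕ)) ^ 2) =
    (2 ^ q * Real.Gamma ((q + 1) / 2) ^ 2 / π) * s ^ (q + 1/2) *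
      (gmC ((q+1)/2) (1/2) n * (ρ ^ 2) ^ n) := by
  have h2s : 0 < 2 * s := by positivity
  have e1 : ((2 * s)⁻¹ ^ (-(q + (2 * n : ℕ) + 1) / 2)) ^ 2 = 2 * 2 ^ q * s ^ (q + 1/2) * √s * (4 ^ n * s ^ (2 * n)) := by
    rw [← Real.rpow_natCast, ← Real.rpow_mul (by positivity), Real.inv_rpow h2s.le,
      ← Real.rpow_neg h2s.le,
      show -(-(q + (2 * n : ℕ) + 1) / 2 * (2 : ℕ)) = (q + 1) + (2 * n : ℕ) by push_cast; ring,
      Real.rpow_add_natCast h2s.ne', Real.mul_rpow (by norm_num) hs.le, Real.rpow_add_one (by norm_num),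
      show q + 1 = (q + 1/2) + 1/2 by ring, Real.rpow_add hs, ← Real.sqrt_eq_rpow, mul_pow, pow_mul 2]
    rw [show ((2:ℝ) ^ 2) = 4 by norm_num]
    ring
  have hg : Real.Gamma ((q + (2 * n : ℕ) + 1) / 2) = risingFactorial ((q+1)/2) n * Real.Gamma ((q+1)/2) := by
    rw [← gm_gamma (by linarith)]
    congr 1; push_cast; ring
  have hr := (gm_rf_pos (show (0:ℝ) < 1/2 by norm_num) n).ne'
  have hf : (n.factorial : ℝ) ≠ 0 := by positivity
  have hss : √s ≠ 0 := by positivity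
  rw [gmM, mul_pow, e1, hg, gm_fact, gmC, div_pow]
  generalize (s : ℝ) ^ (q + 1/2) = A
  generalize (2 : ℝ) ^ q = B
  rw [pow_mul ρ]
  field_simp

theorem gaussian_mixed_power_moment_hypergeometric (m : ℕ) (hm : 1 ≤ m) (q : ℝ)
    (hq : -(1 / 2 : ℝ) < q) (u v : Fin m → ℝ)
    (hu : ∑ j, u j ^ 2 = 1) (hv : ∑ j, v j ^ 2 = 1)
    (huv : (∑ j, u j * v j) ^ 2 < 1) :
    ∫ g : Fin m → ℝ,
        |(∑ j, g j * u j) * (∑ j, g j * v j)| ^ q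
        ∂(Measure.pi fun _ : Fin m => gaussianReal 0 1) =
      (2 ^ q * Real.Gamma ((q + 1) / 2) ^ 2 / Real.pi) *
        ∑' n : ℕ,
          (risingFactorial (-q / 2) n) ^ 2 /
              (risingFactorial (1 / 2) n * (n.factorial : ℝ)) *
            (∑ j, u j * v j) ^ (2 * n) := by
  obtain ⟨ρ, hρ⟩ : ∃ ρ, ∑ j, u j * v j = ρ := ⟨_, rfl⟩
  rw [hρ] at huv ⊢
  have hs : 0 < 1 - ρ ^ 2 := by linarith
  have hs' : √(1 - ρ ^ 2) ≠ 0 := by positivity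
  have hq1 : -1 < q := by linarith
  let w : Fin m → ℝ := fun j => (√(1 - ρ ^ 2))⁻¹ * (v j - ρ * u j)
  have hw : ∑ j, w j ^ 2 = 1 := by
    have : ∑ j, w j ^ 2 = (1 - ρ ^ 2)⁻¹ *
        (∑ j, v j ^ 2 - 2 * ρ * ∑ j, u j * v j + ρ ^ 2 * ∑ j, u j ^ 2) := by
      rw [Finset.mul_sum, Finset.mul_sum, ← Finset.sum_sub_distrib, ← Finset.sum_add_distrib,
        Finset.mul_sum]
      refine Finset.sum_congr rfl fun j _ => ?_
      simp only [w]
      rw [mul_pow, inv_pow, Real.sq_sqrt hs.le]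
      ring
    rw [this, hu, hv, hρ]
    field_simp
    ring
  have huw : ∑ j, u j * w j = 0 := by
    have : ∑ j, u j * w j = (√(1 - ρ ^ 2))⁻¹ * (∑ j, u j * v j - ρ * ∑ j, u j ^ 2) := by
      rw [Finset.mul_sum, ← Finset.sum_sub_distrib, Finset.mul_sum]
      refine Finset.sum_congr rfl fun j _ => ?_
      simp only [w]
      ring
    rw [this, hu, hρ]
    ring
  have hgv : ∀ g : Fin m → ℝ, ∑ j, g j * v j =
      ρ * ∑ j, g j * u j + √(1 - ρ ^ 2) * ∑ j, g j * w j := by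
    intro g
    rw [Finset.mul_sum, Finset.mul_sum, ← Finset.sum_add_distrib]
    refine Finset.sum_congr rfl fun j _ => ?_
    simp only [w]
    field_simp
    ring
  have hb : 0 < (2 * (1 - ρ ^ 2))⁻¹ := by positivity
  have hC : 0 < 2 ^ q * Real.Gamma ((q + 1) / 2) ^ 2 / π := by
    have := Real.Gamma_pos_of_pos (show 0 < (q+1)/2 by linarith)
    positivity
  have ha : 0 < (q + 1) / 2 := by linarith
  have hsum := gm_summable ha (show (0:ℝ) < 1/2 by norm_num) (sq_nonneg ρ) huv
  have hnn : ∀ n, 0 ≤ gmC ((q+1)/2) (1/2) n * (ρ ^ 2) ^ n := fun n => by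
    have := gm_rf_pos (show (0:ℝ) < 1/2 by norm_num) n
    unfold gmC
    positivity
  rw [integral_eq_lintegral_of_nonneg_ae (Filter.Eventually.of_forall fun g => by positivity)
    (Measurable.aestronglyMeasurable (by fun_prop))]
  simp_rw [hgv]
  rw [← lintegral_map (f := fun p : ℝ × ℝ =>
      ENNReal.ofReal (|p.1 * (ρ * p.1 + √(1 - ρ ^ 2) * p.2)| ^ q))
    (g := fun g : Fin m → ℝ => (∑ j, g j * u j, ∑ j, g j * w j)) (by fun_prop) (by fun_prop),
    gm_pi_law m u w hu hw huw, gm_gauss_double ρ huv,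
    gm_double_series hb hq1 _ _ (by positivity)]
  simp_rw [gm_term hq1 hs]
  rw [← ENNReal.ofReal_tsum_of_nonneg (fun n => mul_nonneg (by positivity) (hnn n))
    (hsum.mul_left _), ENNReal.toReal_ofReal (tsum_nonneg fun n => mul_nonneg (by positivity) (hnn n)),
    tsum_mul_left, mul_assoc]
  congr 1
  have := gm_euler ha (show (0:ℝ) < 1/2 by norm_num) (sq_nonneg ρ) huv
  rw [show 2 * ((q+1)/2) - 1/2 = q + 1/2 by ring, show 1/2 - (q+1)/2 = -q/2 by ring] at this
  rw [this]
  simp_rw [pow_mul, gmC]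
end
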